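/- arXiv:2108.00130 — 2 statements merged into one kernel-verified Lean document; each statement's English description precedes it below -/
import Mathlib

section
/- For all τ ∈ ℂ with Im τ > 0, θ'[0; 1/6](0,τ) · θ[0; 1/6](0,τ)² = −(π/3) · θ[0; 0](0,τ) · θ[1/2; 0](0,τ) · θ[1/2; 1/6](0,τ)³, where in [ε'; ε] the first entry is the top characteristic ε' and the second is the bottom characteristic ε. -/
open Complex

/-- The theta function with characteristic `[ε'; ε]`:
`θ[ε';ε](z,τ) = Σ_{n∈ℤ} exp(πi(n+ε')²τ + 2πi(n+ε')(z+ε))`. -/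
noncomputable def jacobiThetaChar (ε' ε : ℝ) (z τ : ℂ) : ℂ :=
  ∑' n : ℤ, Complex.exp ((Real.pi : ℂ) * Complex.I * ((n : ℂ) + (ε' : ℂ)) ^ 2 * τ +
    2 * (Real.pi : ℂ) * Complex.I * ((n : ℂ) + (ε' : ℂ)) * (z + (ε : ℂ)))

/-- The theta derivative `θ'[ε';ε](0,τ) = ∂_z θ[ε';ε](z,τ) |_{z=0}`. -/
noncomputable def jacobiThetaCharDeriv (ε' ε : ℝ) (τ : ℂ) : ℂ :=
  deriv (fun z => jacobiThetaChar ε' ε z τ) 0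


lemma aux_hc {f g : ℤ → ℂ} {s : ℂ} (h : HasSum g s) (e : ∀ n, f n = g n) : HasSum f s := by
  rw [funext e]; exact h

lemma aux_norm (z : ℂ) {τ : ℂ} (hτ : 0 < τ.im) :
    Summable fun n : ℤ => ‖jacobiTheta₂_term n z τ‖ :=
  ((summable_jacobiTheta₂_term_iff z τ).mpr hτ).norm

/-- Odd lattice zero. -/
lemma aux_zero (τ : ℂ) : jacobiTheta₂ (1 / 2 + τ / 2) τ = 0 := by
  have h1 := jacobiTheta₂_add_left' (-(1 / 2 + τ / 2)) τ
  have h2 := jacobiTheta₂_add_left (-(1 / 2 + τ / 2) + τ) τ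
  rw [show -(1 / 2 + τ / 2) + τ + 1 = 1 / 2 + τ / 2 by ring] at h2
  rw [← h2, jacobiTheta₂_neg_left,
    show -(Real.pi : ℂ) * I * (τ + 2 * -(1 / 2 + τ / 2)) = Real.pi * I by ring,
    Complex.exp_pi_mul_I] at h1
  have : (2 : ℂ) * jacobiTheta₂ (1 / 2 + τ / 2) τ = 0 := by linear_combination h1
  simpa using this

noncomputable def auxEquiv : (ℤ × ℤ) ⊕ (ℤ × ℤ) ≃ ℤ × ℤ :=
  Equiv.ofBijective
    (Sum.elim (fun p => (p.1 + p.2, p.1 - p.2)) (fun p => (p.1 + p.2 + 1, p.1 - p.2))) (by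
    constructor
    · rintro (⟨a, b⟩ | ⟨a, b⟩) (⟨c, d⟩ | ⟨c, d⟩) h <;>
        simp only [Sum.elim_inl, Sum.elim_inr, Prod.mk.injEq] at h <;> obtain ⟨h1, h2⟩ := h
      · congr 2 <;> omega
      · omega
      · omega
      · congr 2 <;> omega
    · rintro ⟨n, m⟩
      rcases Int.even_or_odd (n + m) with ⟨k, hk⟩ | ⟨k, hk⟩
      · exact ⟨Sum.inl (k, n - k), by
          simp only [Sum.elim_inl, Prod.mk.injEq]; constructor <;> omega⟩
      · exact ⟨Sum.inr (k, n - k - 1), by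
          simp only [Sum.elim_inr, Prod.mk.injEq]; constructor <;> omega⟩)

lemma auxEquiv_inl (p : ℤ × ℤ) : auxEquiv (Sum.inl p) = (p.1 + p.2, p.1 - p.2) := rfl

lemma auxEquiv_inr (p : ℤ × ℤ) : auxEquiv (Sum.inr p) = (p.1 + p.2 + 1, p.1 - p.2) := rfl

lemma aux_bin (x y : ℂ) {τ : ℂ} (hτ : 0 < τ.im) :
    jacobiTheta₂ x τ * jacobiTheta₂ y τ =
      jacobiTheta₂ (x + y) (2 * τ) * jacobiTheta₂ (x - y) (2 * τ) +
      cexp (Real.pi * I * τ + 2 * Real.pi * I * x) *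
        (jacobiTheta₂ (x + y + τ) (2 * τ) * jacobiTheta₂ (x - y + τ) (2 * τ)) := by
  have hτ2 : 0 < (2 * τ).im := by simp [hτ]
  have hs := summable_mul_of_summable_norm (aux_norm x hτ) (aux_norm y hτ)
  unfold jacobiTheta₂
  rw [tsum_mul_tsum_of_summable_norm (aux_norm x hτ) (aux_norm y hτ),
    tsum_mul_tsum_of_summable_norm (aux_norm _ hτ2) (aux_norm _ hτ2),
    tsum_mul_tsum_of_summable_norm (aux_norm _ hτ2) (aux_norm _ hτ2), ← tsum_mul_left,
    ← auxEquiv.tsum_eq]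
  have hs' := (auxEquiv.summable_iff).mpr hs
  have hl := hs'.comp_injective Sum.inl_injective
  have hr := hs'.comp_injective Sum.inr_injective
  refine (Summable.tsum_sum hl hr).trans ?_
  congr 1
  · refine tsum_congr fun p => ?_
    simp only [Function.comp, auxEquiv_inl, jacobiTheta₂_term, ← Complex.exp_add]
    congr 1; push_cast; ring
  · refine tsum_congr fun p => ?_
    simp only [Function.comp, auxEquiv_inr, jacobiTheta₂_term, ← Complex.exp_add]
    congr 1; push_cast; ring

noncomputable def auxC (a b c τ : ℂ) (N : ℤ) : ℂ :=
  ∑' p : ℤ × ℤ, jacobiTheta₂_term p.1 a τ * jacobiTheta₂_term p.2 b τ *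
    jacobiTheta₂_term (N - p.1 - p.2) c τ

def auxEquiv3 : ℤ × (ℤ × ℤ) ≃ (ℤ × ℤ) × ℤ where
  toFun x := (x.2, x.1 - x.2.1 - x.2.2)
  invFun y := (y.2 + y.1.1 + y.1.2, y.1)
  left_inv x := by ext <;> simp <;> ring
  right_inv x := by ext <;> simp <;> ring

lemma aux_tri0 (f g h : ℤ → ℂ) (A B C : ℂ) (hf : HasSum f A) (hg : HasSum g B) (hh : HasSum h C)
    (nf : Summable fun n => ‖f n‖) (ng : Summable fun n => ‖g n‖) (nh : Summable fun n => ‖h n‖) :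
    HasSum (fun N : ℤ => ∑' p : ℤ × ℤ, f p.1 * g p.2 * h (N - p.1 - p.2)) (A * B * C) := by
  have s12 := summable_mul_of_summable_norm nf ng
  have h12 : HasSum (fun p : ℤ × ℤ => f p.1 * g p.2) (A * B) := HasSum.mul hf hg s12
  generalize hk : (fun p : ℤ × ℤ => f p.1 * g p.2) = k at h12
  have hk' : ∀ p : ℤ × ℤ, f p.1 * g p.2 = k p := fun p => by rw [← hk]
  simp only [hk']
  have nk : Summable fun p => ‖k p‖ := h12.summable.norm
  have h3 : HasSum (fun x : (ℤ × ℤ) × ℤ => k x.1 * h x.2) (A * B * C) :=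
    HasSum.mul h12 hh (summable_mul_of_summable_norm nk nh)
  have hh2 := auxEquiv3.hasSum_iff.mpr h3
  exact HasSum.prod_fiberwise hh2 fun N => (hh2.summable.prod_factor N).hasSum

lemma aux_tri (a b c z : ℂ) {τ : ℂ} (hτ : 0 < τ.im) :
    HasSum (fun N : ℤ => auxC a b c τ N * cexp (2 * Real.pi * I * N * z))
      (jacobiTheta₂ (z + a) τ * jacobiTheta₂ (z + b) τ * jacobiTheta₂ (z + c) τ) := by
  have h3 := aux_tri0 _ _ _ _ _ _ (hasSum_jacobiTheta₂_term (z + a) hτ)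
    (hasSum_jacobiTheta₂_term (z + b) hτ) (hasSum_jacobiTheta₂_term (z + c) hτ)
    (aux_norm (z + a) hτ) (aux_norm (z + b) hτ) (aux_norm (z + c) hτ)
  refine aux_hc h3 fun N => ?_
  rw [auxC, ← tsum_mul_right]
  refine tsum_congr fun p => ?_
  simp only [jacobiTheta₂_term, ← Complex.exp_add]
  congr 1; push_cast; ring

lemma auxC_rec (a b c τ : ℂ) (h : a + b + c = 1 / 2) (N : ℤ) :
    auxC a b c τ (N + 3) = -cexp (Real.pi * I * (2 * N + 3) * τ) * auxC a b c τ N := by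
  have e1 : -cexp (Real.pi * I * (2 * N + 3) * τ) =
      cexp (Real.pi * I * (2 * N + 3) * τ + 2 * Real.pi * I * (a + b + c)) := by
    rw [h, Complex.exp_add, show 2 * (Real.pi : ℂ) * I * (1 / 2) = Real.pi * I by ring,
      Complex.exp_pi_mul_I]; ring
  rw [e1, auxC, auxC, ← tsum_mul_left,
    ← (Equiv.prodCongr (Equiv.addRight (1 : ℤ)) (Equiv.addRight (1 : ℤ))).tsum_eq]
  refine tsum_congr fun p => ?_
  simp only [Equiv.prodCongr_apply, Prod.map, Equiv.coe_addRight, jacobiTheta₂_term,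
    ← Complex.exp_add]
  congr 1; push_cast; ring

lemma aux_vanish (τ : ℂ) (X : ℤ → ℂ)
    (hX : ∀ N : ℤ, X (N + 3) = -cexp (Real.pi * I * (2 * N + 3) * τ) * X N)
    (h0 : X 0 = 0) (h1 : X 1 = 0) (h2 : X (-1) = 0) : ∀ N, X N = 0 := by
  have up : ∀ N, X N = 0 → X (N + 3) = 0 := fun N h => by rw [hX, h, mul_zero]
  have dn : ∀ N, X (N + 3) = 0 → X N = 0 := fun N h => by
    rw [hX] at h
    simpa [Complex.exp_ne_zero] using h
  have key : ∀ r : ℤ, X r = 0 → ∀ m : ℤ, X (r + 3 * m) = 0 := by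
    intro r hr m
    induction m using Int.induction_on with
    | zero => simpa using hr
    | succ i ih => have := up _ ih; rwa [show r + 3 * (i : ℤ) + 3 = r + 3 * (i + 1) by ring] at this
    | pred i ih =>
      apply dn
      rwa [show r + 3 * (-(i : ℤ) - 1) + 3 = r + 3 * (-i) by ring]
  intro N
  have : N % 3 = 0 ∨ N % 3 = 1 ∨ N % 3 = 2 := by omega
  rcases this with h | h | h
  · have := key 0 h0 (N / 3); rwa [show 0 + 3 * (N / 3) = N by omega] at this
  · have := key 1 h1 (N / 3); rwa [show 1 + 3 * (N / 3) = N by omega] at this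
  · have := key (-1) h2 (N / 3 + 1); rwa [show -1 + 3 * (N / 3 + 1) = N by omega] at this

noncomputable def auxF (a b c τ z : ℂ) : ℂ :=
  jacobiTheta₂ (z + a) τ * jacobiTheta₂ (z + b) τ * jacobiTheta₂ (z + c) τ

noncomputable def auxD (a b c τ : ℂ) (N : ℤ) : ℂ := auxC a b c τ N - auxC a b c τ (-N)

lemma auxD_hasSum (a b c z : ℂ) {τ : ℂ} (hτ : 0 < τ.im) :
    HasSum (fun N : ℤ => auxD a b c τ N * cexp (2 * Real.pi * I * N * z))
      (auxF a b c τ z - auxF a b c τ (-z)) := by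
  have h1 := aux_tri a b c z hτ
  have h2 := (Equiv.neg ℤ).hasSum_iff.mpr (aux_tri a b c (-z) hτ)
  have h3 := h1.sub h2
  refine aux_hc h3 fun N => ?_
  simp only [auxD, Function.comp, Equiv.neg_apply]
  rw [sub_mul]
  congr 3
  push_cast; ring

lemma auxD_rec (a b c τ : ℂ) (h : a + b + c = 1 / 2) (N : ℤ) :
    auxD a b c τ (N + 3) = -cexp (Real.pi * I * (2 * N + 3) * τ) * auxD a b c τ N := by
  have h1 := auxC_rec a b c τ h N
  have h2 := auxC_rec a b c τ h (-(N + 3))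
  rw [show -(N + 3) + 3 = -N by ring] at h2
  have h3 : cexp (Real.pi * I * (2 * N + 3) * τ) *
      cexp (Real.pi * I * (2 * ((-(N + 3) : ℤ) : ℂ) + 3) * τ) = 1 := by
    rw [← Complex.exp_add, ← Complex.exp_zero]; congr 1; push_cast; ring
  rw [auxD, auxD, h1, h2]
  linear_combination (auxC a b c τ (-(N+3))) * h3

lemma aux_prop (a b c a' b' c' z y : ℂ) {τ : ℂ} (hτ : 0 < τ.im)
    (h : a + b + c = 1 / 2) (h' : a' + b' + c' = 1 / 2) :
    (auxF a b c τ z - auxF a b c τ (-z)) * (auxF a' b' c' τ y - auxF a' b' c' τ (-y)) =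
    (auxF a b c τ y - auxF a b c τ (-y)) * (auxF a' b' c' τ z - auxF a' b' c' τ (-z)) := by
  have d0 : ∀ a b c, auxD a b c τ 0 = 0 := fun a b c => by simp [auxD]
  have dm : ∀ a b c, auxD a b c τ (-1) = - auxD a b c τ 1 := fun a b c => by simp [auxD]
  have r := auxD_rec a b c τ h
  have r' := auxD_rec a' b' c' τ h'
  by_cases h1 : auxD a b c τ 1 = 0
  · have hv := aux_vanish τ (auxD a b c τ) r (d0 _ _ _) h1 (by rw [dm, h1, neg_zero])
    have hz : ∀ z, auxF a b c τ z - auxF a b c τ (-z) = 0 := fun z => by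
      have := auxD_hasSum a b c z hτ
      simp only [hv, zero_mul] at this
      exact this.unique hasSum_zero
    rw [hz, hz]; ring
  · have hv := aux_vanish τ
      (fun N => auxD a' b' c' τ N - auxD a' b' c' τ 1 / auxD a b c τ 1 * auxD a b c τ N)
      (fun N => by simp only [r, r']; ring) (by simp [d0]) (by field_simp; ring)
      (by simp only [dm]; field_simp; ring)
    have hz : ∀ z, auxF a' b' c' τ z - auxF a' b' c' τ (-z) =
        auxD a' b' c' τ 1 / auxD a b c τ 1 * (auxF a b c τ z - auxF a b c τ (-z)) := fun z => by
      have g1 := (auxD_hasSum a b c z hτ).mul_left (auxD a' b' c' τ 1 / auxD a b c τ 1)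
      refine (auxD_hasSum a' b' c' z hτ).unique ?_
      refine aux_hc g1 fun N => ?_
      rw [sub_eq_zero.mp (hv N)]; ring
    rw [hz, hz]; ring


lemma aux_B1 (x : ℂ) {τ : ℂ} (hτ : 0 < τ.im) :
    jacobiTheta₂ x τ * jacobiTheta₂ (x + 1 / 2) τ =
      jacobiTheta₂ (2 * x + 1 / 2) (2 * τ) * jacobiTheta₂ (1 / 2) (2 * τ) := by
  have h := aux_bin x (x + 1 / 2) hτ
  have h0 := aux_zero (2 * τ)
  have h1 := jacobiTheta₂_add_left (x - (x + 1 / 2) + τ) (2 * τ)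
  rw [show x - (x + 1 / 2) + τ + 1 = 1 / 2 + 2 * τ / 2 by ring, h0] at h1
  rw [h, ← h1, show x - (x + 1 / 2) = -(1 / 2) by ring, jacobiTheta₂_neg_left,
    show x + (x + 1 / 2) = 2 * x + 1 / 2 by ring]
  ring

lemma aux_B3 (x : ℂ) {τ : ℂ} (hτ : 0 < τ.im) :
    jacobiTheta₂ (x + τ / 2) τ * jacobiTheta₂ (τ / 2) τ =
      2 * (jacobiTheta₂ x (2 * τ) * jacobiTheta₂ (x + τ) (2 * τ)) := by
  have h := aux_bin (x + τ / 2) (τ / 2) hτ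
  have h1 := jacobiTheta₂_add_left' x (2 * τ)
  rw [h, show x + τ / 2 + τ / 2 + τ = x + 2 * τ by ring, h1,
    show x + τ / 2 + τ / 2 = x + τ by ring, show x + τ / 2 - τ / 2 = x by ring]
  have h2 : cexp (Real.pi * I * τ + 2 * Real.pi * I * (x + τ / 2)) *
      cexp (-Real.pi * I * (2 * τ + 2 * x)) = 1 := by
    rw [← Complex.exp_add, ← Complex.exp_zero]; congr 1; ring
  linear_combination (jacobiTheta₂ x (2 * τ) * jacobiTheta₂ (x + τ) (2 * τ)) * h2

noncomputable def auxP (τ : ℂ) : ℂ :=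
  jacobiTheta₂ 0 τ * jacobiTheta₂ (1 / 2) τ * jacobiTheta₂ (τ / 2) τ

noncomputable def auxN (τ : ℂ) : ℂ := jacobiTheta₂' (1 / 2 + τ / 2) τ

noncomputable def auxS (τ : ℂ) : ℂ :=
  jacobiTheta₂ (1 / 6) τ * jacobiTheta₂ (2 / 3) τ * jacobiTheta₂ (1 / 6 + τ / 2) τ *
    jacobiTheta₂ (2 / 3 + τ / 2) τ

lemma aux_00 {τ : ℂ} (hτ : 0 < τ.im) :
    jacobiTheta₂ 0 τ * jacobiTheta₂ (1 / 2) τ = jacobiTheta₂ (1 / 2) (2 * τ) ^ 2 := by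
  have h1 := aux_B1 0 hτ
  rw [zero_add, mul_zero, zero_add] at h1
  rw [h1]; ring

lemma auxP_double {τ : ℂ} (hτ : 0 < τ.im) :
    auxP τ * jacobiTheta₂ (τ / 2) τ = 2 * auxP (2 * τ) * jacobiTheta₂ (1 / 2) (2 * τ) := by
  have h1 := aux_00 hτ
  have h3 := aux_B3 0 hτ
  rw [zero_add, zero_add] at h3
  rw [auxP, auxP, h1, show 2 * τ / 2 = τ by ring]
  linear_combination (jacobiTheta₂ (1 / 2) (2 * τ) ^ 2) * h3

lemma auxN_double {τ : ℂ} (hτ : 0 < τ.im) :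
    auxN τ * jacobiTheta₂ (τ / 2) τ = 2 * auxN (2 * τ) * jacobiTheta₂ (1 / 2) (2 * τ) := by
  have hτ2 : 0 < (2 * τ).im := by simp [hτ]
  have l1 := hasDerivAt_jacobiTheta₂_fst (τ / 2) hτ
  have l2 := (hasDerivAt_jacobiTheta₂_fst (τ / 2 + 1 / 2) hτ).comp_add_const (τ / 2) (1 / 2)
  have l3 := l1.mul l2
  have r1 := (hasDerivAt_jacobiTheta₂_fst (2 * (τ / 2) + 1 / 2) hτ2).comp (τ / 2)
    (((hasDerivAt_id (τ / 2)).const_mul 2).add_const (1 / 2))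
  have r2 := r1.mul_const (jacobiTheta₂ (1 / 2) (2 * τ))
  have e : ((fun x => jacobiTheta₂ x τ) * fun x => jacobiTheta₂ (x + 1 / 2) τ) =
      fun y => ((fun x => jacobiTheta₂ x (2 * τ)) ∘ fun x => 2 * id x + 1 / 2) y *
        jacobiTheta₂ (1 / 2) (2 * τ) := by
    funext x
    exact aux_B1 x hτ
  rw [e] at l3
  have h := l3.unique r2
  have h0 := aux_zero τ
  rw [show τ / 2 + 1 / 2 = 1 / 2 + τ / 2 by ring, h0] at h
  rw [auxN, auxN, show 1 / 2 + 2 * τ / 2 = 2 * (τ / 2) + 1 / 2 by ring]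
  linear_combination h

lemma aux_sixth (τ : ℂ) : jacobiTheta₂ (5 / 6 + τ / 2) τ =
    cexp (Real.pi * I / 3) * jacobiTheta₂ (1 / 6 + τ / 2) τ := by
  have h1 := jacobiTheta₂_add_left (-(1 / 6 + τ / 2) + τ) τ
  rw [show -(1 / 6 + τ / 2) + τ + 1 = 5 / 6 + τ / 2 by ring, jacobiTheta₂_add_left',
    jacobiTheta₂_neg_left] at h1
  rw [h1]
  congr 2; ring

lemma aux_56 (τ : ℂ) : jacobiTheta₂ (5 / 6) τ = jacobiTheta₂ (1 / 6) τ := by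
  have h1 := jacobiTheta₂_add_left (-(1 / 6)) τ
  rwa [show -(1 / 6) + 1 = (5 / 6 : ℂ) by norm_num, jacobiTheta₂_neg_left] at h1

lemma auxS_double {τ : ℂ} (hτ : 0 < τ.im) :
    auxS τ = cexp (Real.pi * I / 3) * (jacobiTheta₂ (1 / 6) (2 * τ) *
      jacobiTheta₂ (1 / 6 + τ) (2 * τ)) * jacobiTheta₂ (1 / 2) (2 * τ) ^ 2 := by
  have h1 := aux_B1 (1 / 6) hτ
  have h2 := aux_B1 (1 / 6 + τ / 2) hτ
  have h3 := aux_sixth (2 * τ)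
  rw [show 2 * τ / 2 = τ by ring] at h3
  rw [show (1 / 6 : ℂ) + 1 / 2 = 2 / 3 by norm_num,
    show (2 : ℂ) * (1 / 6) + 1 / 2 = 5 / 6 by norm_num, aux_56] at h1
  rw [show 1 / 6 + τ / 2 + 1 / 2 = 2 / 3 + τ / 2 by ring,
    show 2 * (1 / 6 + τ / 2) + 1 / 2 = 5 / 6 + τ by ring, h3] at h2
  have : auxS τ = (jacobiTheta₂ (1 / 6) τ * jacobiTheta₂ (2 / 3) τ) *
    (jacobiTheta₂ (1 / 6 + τ / 2) τ * jacobiTheta₂ (2 / 3 + τ / 2) τ) := by rw [auxS]; ring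
  rw [this, h1, h2]; ring

lemma auxS_eq {τ : ℂ} (hτ : 0 < τ.im) :
    2 * auxS τ = cexp (Real.pi * I / 3) * jacobiTheta₂ (1 / 6 + τ / 2) τ * auxP τ := by
  have h3 := aux_B3 (1 / 6) hτ
  have h0 := aux_00 hτ
  rw [auxS_double hτ, ← h0, auxP]
  linear_combination (-cexp (Real.pi * I / 3) * (jacobiTheta₂ 0 τ * jacobiTheta₂ (1 / 2) τ)) * h3

lemma aux_desc {τ : ℂ} (hτ : 0 < τ.im) (h : auxP (2 * τ) ≠ 0 ∧ auxS (2 * τ) ≠ 0) :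
    auxP τ ≠ 0 ∧ auxS τ ≠ 0 := by
  obtain ⟨hP, hS⟩ := h
  have hP' := hP
  have hS' := hS
  rw [auxP] at hP'
  rw [auxS, show 2 * τ / 2 = τ by ring] at hS'
  simp only [mul_ne_zero_iff] at hP' hS'
  constructor
  · intro h
    have := auxP_double hτ
    rw [h, zero_mul] at this
    have h2 : 2 * auxP (2 * τ) * jacobiTheta₂ (1 / 2) (2 * τ) ≠ 0 :=
      mul_ne_zero (mul_ne_zero two_ne_zero hP) hP'.1.2
    exact h2 this.symm
  · rw [auxS_double hτ]
    exact mul_ne_zero (mul_ne_zero (Complex.exp_ne_zero _) (mul_ne_zero hS'.1.1.1 hS'.1.2))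
      (pow_ne_zero _ hP'.1.2)

lemma aux_im {τ : ℂ} (hτ : 0 < τ.im) (k : ℕ) : 0 < (2 ^ k * τ).im := by
  have : (2 ^ k * τ : ℂ) = ((2 ^ k : ℝ) : ℂ) * τ := by push_cast; ring
  rw [this, Complex.im_ofReal_mul]; positivity

lemma aux_desc' (k : ℕ) : ∀ {τ : ℂ}, 0 < τ.im →
    (auxP (2 ^ k * τ) ≠ 0 ∧ auxS (2 ^ k * τ) ≠ 0) → auxP τ ≠ 0 ∧ auxS τ ≠ 0 := by
  induction k with
  | zero => intro τ _ h; simpa using h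
  | succ k ih =>
    intro τ hτ h
    apply ih hτ
    apply aux_desc (aux_im hτ k)
    rwa [show (2 : ℂ) * (2 ^ k * τ) = 2 ^ (k + 1) * τ by ring]

lemma aux_lim (c : ℤ → ℂ) (e : ℤ → ℝ) (he : ∀ n, 0 ≤ e n) {τ : ℂ} (hτ : 0 < τ.im)
    (hs : Summable fun n => ‖c n * cexp (Real.pi * I * e n * τ)‖)
    (s : Finset ℤ) (hs0 : ∀ n, e n = 0 ↔ n ∈ s) :
    Filter.Tendsto (fun k : ℕ => ∑' n, c n * cexp (Real.pi * I * e n * (2 ^ k * τ)))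
      Filter.atTop (nhds (∑ n ∈ s, c n)) := by
  have hn : ∀ (n : ℤ) (k : ℕ), ‖cexp (Real.pi * I * e n * (2 ^ k * τ))‖ =
      Real.exp (-(Real.pi * e n * τ.im) * 2 ^ k) := by
    intro n k
    rw [Complex.norm_exp]
    congr 1
    rw [show (Real.pi * I * e n * (2 ^ k * τ) : ℂ) = ((Real.pi * e n * 2 ^ k : ℝ) : ℂ) * (I * τ) by
      push_cast; ring, Complex.re_ofReal_mul]
    simp; ring
  have hsum : ∑ n ∈ s, c n = ∑' n, if n ∈ s then c n else 0 := by
    rw [tsum_eq_sum (s := s)]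
    · exact Finset.sum_congr rfl fun n h => by simp [h]
    · intro n h; simp [h]
  rw [hsum]
  refine tendsto_tsum_of_dominated_convergence hs (fun n => ?_) (Filter.Eventually.of_forall
    fun k n => ?_)
  · by_cases h : n ∈ s
    · have := (hs0 n).mpr h
      simp [h, this]
    · have hpos : 0 < e n := lt_of_le_of_ne (he n) fun h' => h ((hs0 n).mp h'.symm)
      simp only [h, if_false]
      rw [show (0 : ℂ) = c n * 0 by simp]
      refine Filter.Tendsto.const_mul _ ?_
      rw [tendsto_zero_iff_norm_tendsto_zero]
      simp only [hn]
      refine Real.tendsto_exp_atBot.comp ?_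
      refine Filter.Tendsto.const_mul_atTop_of_neg (by have := Real.pi_pos; simp; positivity) ?_
      exact tendsto_pow_atTop_atTop_of_one_lt (by norm_num)
  · rw [norm_mul, norm_mul]
    gcongr
    have h0 := hn n 0
    simp only [pow_zero, one_mul, mul_one] at h0
    rw [hn, h0, Real.exp_le_exp]
    have : (1 : ℝ) ≤ 2 ^ k := one_le_pow₀ (by norm_num)
    have h2 : 0 ≤ Real.pi * e n * τ.im := by have := Real.pi_pos; have := he n; positivity
    nlinarith

lemma aux_lim0 (a : ℂ) {τ : ℂ} (hτ : 0 < τ.im) :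
    Filter.Tendsto (fun k : ℕ => jacobiTheta₂ a (2 ^ k * τ)) Filter.atTop (nhds 1) := by
  have key : ∀ σ : ℂ, ∀ n : ℤ, cexp (2 * Real.pi * I * n * a) *
      cexp (Real.pi * I * ((n ^ 2 : ℝ) : ℂ) * σ) = jacobiTheta₂_term n a σ := by
    intro σ n
    rw [jacobiTheta₂_term, ← Complex.exp_add]; congr 1; push_cast; ring
  have h := aux_lim (fun n => cexp (2 * Real.pi * I * n * a)) (fun n => (n : ℝ) ^ 2)
    (fun n => sq_nonneg _) hτ (by simp only [key]; exact aux_norm a hτ) {0} (by simp)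
  simp only [key] at h
  change Filter.Tendsto (fun k : ℕ => jacobiTheta₂ a (2 ^ k * τ)) _ _ at h
  simpa using h

lemma aux_int (n : ℤ) : 0 ≤ (n : ℝ) ^ 2 + n := by
  have : 0 ≤ n ^ 2 + n := by
    rcases le_or_gt 0 n with h | h
    · positivity
    · nlinarith
  exact_mod_cast this

lemma aux_int0 (n : ℤ) : (n : ℝ) ^ 2 + n = 0 ↔ n ∈ ({0, -1} : Finset ℤ) := by
  have : (n : ℝ) ^ 2 + n = 0 ↔ n * (n + 1) = 0 := by
    rw [show (n : ℝ) ^ 2 + n = ((n * (n + 1) : ℤ) : ℝ) by push_cast; ring]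
    exact Int.cast_eq_zero
  rw [this, mul_eq_zero]
  simp only [Finset.mem_insert, Finset.mem_singleton]
  omega

lemma aux_lim1 (a : ℂ) {τ : ℂ} (hτ : 0 < τ.im) :
    Filter.Tendsto (fun k : ℕ => jacobiTheta₂ (a + 2 ^ k * τ / 2) (2 ^ k * τ)) Filter.atTop
      (nhds (1 + cexp (-(2 * Real.pi * I * a)))) := by
  have key : ∀ σ : ℂ, ∀ n : ℤ, cexp (2 * Real.pi * I * n * a) *
      cexp (Real.pi * I * ((n ^ 2 + n : ℝ) : ℂ) * σ) = jacobiTheta₂_term n (a + σ / 2) σ := by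
    intro σ n
    rw [jacobiTheta₂_term, ← Complex.exp_add]; congr 1; push_cast; ring
  have h := aux_lim (fun n => cexp (2 * Real.pi * I * n * a)) (fun n => (n : ℝ) ^ 2 + n)
    aux_int hτ (by simp only [key]; exact aux_norm _ hτ) {0, -1} aux_int0
  simp only [key] at h
  change Filter.Tendsto (fun k : ℕ => jacobiTheta₂ (a + 2 ^ k * τ / 2) (2 ^ k * τ)) _ _ at h
  simpa using h

lemma aux_lim2 {τ : ℂ} (hτ : 0 < τ.im) :
    Filter.Tendsto (fun k : ℕ => auxN (2 ^ k * τ)) Filter.atTop (nhds (2 * Real.pi * I)) := by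
  have key : ∀ σ : ℂ, ∀ n : ℤ, 2 * Real.pi * I * n * cexp (Real.pi * I * n) *
      cexp (Real.pi * I * ((n ^ 2 + n : ℝ) : ℂ) * σ) = jacobiTheta₂'_term n (1 / 2 + σ / 2) σ := by
    intro σ n
    rw [jacobiTheta₂'_term, jacobiTheta₂_term, mul_assoc, ← Complex.exp_add]
    congr 2; push_cast; ring
  have h := aux_lim (fun n => 2 * Real.pi * I * n * cexp (Real.pi * I * n))
    (fun n => (n : ℝ) ^ 2 + n) aux_int hτ
    (by simp only [key]; exact ((summable_jacobiTheta₂'_term_iff _ τ).mpr hτ).norm) {0, -1} aux_int0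
  simp only [key] at h
  change Filter.Tendsto (fun k : ℕ => auxN (2 ^ k * τ)) _ _ at h
  simpa [Complex.exp_neg] using h

lemma aux_limP {τ : ℂ} (hτ : 0 < τ.im) :
    Filter.Tendsto (fun k : ℕ => auxP (2 ^ k * τ)) Filter.atTop (nhds 2) := by
  have h := ((aux_lim0 0 hτ).mul (aux_lim0 (1 / 2) hτ)).mul (aux_lim1 0 hτ)
  simp only [zero_add, mul_zero, neg_zero, Complex.exp_zero, one_mul] at h
  rw [one_add_one_eq_two] at h
  exact h

lemma aux_limS {τ : ℂ} (hτ : 0 < τ.im) :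
    Filter.Tendsto (fun k : ℕ => auxS (2 ^ k * τ)) Filter.atTop
      (nhds (1 * 1 * (1 + cexp (-(2 * Real.pi * I * (1 / 6)))) *
        (1 + cexp (-(2 * Real.pi * I * (2 / 3)))))) :=
  (((aux_lim0 (1 / 6) hτ).mul (aux_lim0 (2 / 3) hτ)).mul (aux_lim1 (1 / 6) hτ)).mul
    (aux_lim1 (2 / 3) hτ)

lemma aux_c1 : 1 + cexp (-(2 * Real.pi * I * (1 / 6))) ≠ 0 := by
  intro h
  have h2 := congrArg Complex.re h
  rw [show -(2 * (Real.pi : ℂ) * I * (1 / 6)) = ((-(Real.pi / 3) : ℝ) : ℂ) * I by push_cast; ring,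
    Complex.add_re, Complex.exp_ofReal_mul_I_re, Real.cos_neg, Real.cos_pi_div_three] at h2
  norm_num at h2

lemma aux_c2 : 1 + cexp (-(2 * Real.pi * I * (2 / 3))) ≠ 0 := by
  intro h
  have h1 : cexp (-(2 * Real.pi * I * (2 / 3))) = -1 := by linear_combination h
  have h2 : cexp (-(2 * Real.pi * I * (2 / 3))) ^ 3 = 1 := by
    rw [← Complex.exp_nat_mul,
      show ((3 : ℕ) : ℂ) * -(2 * Real.pi * I * (2 / 3)) = ((-2 : ℤ) : ℂ) * (2 * Real.pi * I) by
        push_cast; ring]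
    exact Complex.exp_int_mul_two_pi_mul_I _
  rw [h1] at h2
  norm_num at h2

lemma aux_ne {τ : ℂ} (hτ : 0 < τ.im) : auxP τ ≠ 0 ∧ auxS τ ≠ 0 := by
  have h1 := (aux_limP hτ).eventually_ne (two_ne_zero)
  have h2 := (aux_limS hτ).eventually_ne (by
    rw [one_mul, one_mul]; exact mul_ne_zero aux_c1 aux_c2)
  obtain ⟨k, hk⟩ := (h1.and h2).exists
  exact aux_desc' k hτ hk

lemma aux_J {τ : ℂ} (hτ : 0 < τ.im) : auxN τ = Real.pi * I * auxP τ := by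
  have hR : ∀ σ : ℂ, 0 < σ.im → auxN (2 * σ) / auxP (2 * σ) = auxN σ / auxP σ := by
    intro σ hσ
    have hσ2 : 0 < (2 * σ).im := by simp [hσ]
    have p1 := (aux_ne hσ).1
    have p2 := (aux_ne hσ2).1
    have t : jacobiTheta₂ (σ / 2) σ ≠ 0 := by
      have := p1; rw [auxP] at this; exact right_ne_zero_of_mul this
    have hp := auxP_double hσ
    have hn := auxN_double hσ
    rw [div_eq_div_iff p2 p1]
    apply mul_right_cancel₀ t
    linear_combination auxN (2 * σ) * hp - auxP (2 * σ) * hn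
  have hR' : ∀ k : ℕ, auxN (2 ^ k * τ) / auxP (2 ^ k * τ) = auxN τ / auxP τ := by
    intro k
    induction k with
    | zero => simp
    | succ k ih =>
      rw [← ih, ← hR _ (aux_im hτ k), show (2 : ℂ) * (2 ^ k * τ) = 2 ^ (k + 1) * τ by ring]
  have hl := (aux_lim2 hτ).div (aux_limP hτ) two_ne_zero
  have hl2 : Filter.Tendsto (fun k : ℕ => auxN (2 ^ k * τ) / auxP (2 ^ k * τ)) Filter.atTop
      (nhds (2 * Real.pi * I / 2)) := hl
  simp only [hR'] at hl2
  have := tendsto_nhds_unique hl2 tendsto_const_nhds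
  have p1 := (aux_ne hτ).1
  field_simp at this
  linear_combination -this

lemma aux_K {τ : ℂ} (hτ : 0 < τ.im) :
    cexp (Real.pi * I / 3) * auxN τ = 2 * Real.pi * I *
      (jacobiTheta₂ (1 / 6) τ * jacobiTheta₂ (2 / 3) τ * jacobiTheta₂ (2 / 3 + τ / 2) τ) := by
  have h := auxS_eq hτ
  have hS := (aux_ne hτ).2
  rw [auxS] at h hS
  have t := right_ne_zero_of_mul (left_ne_zero_of_mul hS)
  rw [aux_J hτ]
  apply mul_right_cancel₀ t
  linear_combination -Real.pi * I * h

lemma aux_main {τ : ℂ} (hτ : 0 < τ.im) :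
    jacobiTheta₂' (1 / 6) τ * jacobiTheta₂ (1 / 6) τ ^ 2 =
      -(Real.pi * I / 3) * cexp (Real.pi * I * τ) * jacobiTheta₂ 0 τ * jacobiTheta₂ (τ / 2) τ *
        jacobiTheta₂ (1 / 6 + τ / 2) τ ^ 3 := by
  set y : ℂ := 2 / 3 + τ / 2 with hy
  -- the two odd functions
  have hg : ∀ z, auxF (1 / 6) (1 / 6) (1 / 6) τ z - auxF (1 / 6) (1 / 6) (1 / 6) τ (-z) =
      jacobiTheta₂ (z + 1 / 6) τ ^ 3 - jacobiTheta₂ (z + -(1 / 6)) τ ^ 3 := by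
    intro z
    rw [auxF, auxF, show -z + 1 / 6 = -(z + -(1 / 6)) by ring, jacobiTheta₂_neg_left]; ring
  have hH : ∀ z, auxF (1 / 2 + τ / 2) (-(τ / 2)) 0 τ z - auxF (1 / 2 + τ / 2) (-(τ / 2)) 0 τ (-z) =
      2 * (jacobiTheta₂ (z + (1 / 2 + τ / 2)) τ * jacobiTheta₂ (z + -(τ / 2)) τ *
        jacobiTheta₂ z τ) := by
    intro z
    have e1 := jacobiTheta₂_add_left' (z + -(1 / 2 + τ / 2)) τ
    have e2 := jacobiTheta₂_add_left' (z + -(τ / 2)) τ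
    have e3 := jacobiTheta₂_add_left (z + -(1 / 2 + τ / 2) + τ) τ
    rw [show z + -(1 / 2 + τ / 2) + τ + 1 = z + (1 / 2 + τ / 2) by ring, e1] at e3
    rw [auxF, auxF, show -z + (1 / 2 + τ / 2) = -(z + -(1 / 2 + τ / 2)) by ring,
      show -z + -(τ / 2) = -(z + -(τ / 2) + τ) by ring, add_zero, add_zero,
      jacobiTheta₂_neg_left, jacobiTheta₂_neg_left, jacobiTheta₂_neg_left, e2, e3]
    have e4 : cexp (-Real.pi * I * (τ + 2 * (z + -(1 / 2 + τ / 2)))) =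
        -cexp (-Real.pi * I * (τ + 2 * (z + -(τ / 2)))) := by
      rw [show -(Real.pi : ℂ) * I * (τ + 2 * (z + -(1 / 2 + τ / 2))) =
        -Real.pi * I * (τ + 2 * (z + -(τ / 2))) + Real.pi * I by ring, Complex.exp_add,
        Complex.exp_pi_mul_I]; ring
    rw [e4]; ring
  have hp : ∀ z, (jacobiTheta₂ (z + 1 / 6) τ ^ 3 - jacobiTheta₂ (z + -(1 / 6)) τ ^ 3) *
      (jacobiTheta₂ (y + (1 / 2 + τ / 2)) τ * jacobiTheta₂ (y + -(τ / 2)) τ * jacobiTheta₂ y τ) =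
      (jacobiTheta₂ (y + 1 / 6) τ ^ 3 - jacobiTheta₂ (y + -(1 / 6)) τ ^ 3) *
      (jacobiTheta₂ (z + (1 / 2 + τ / 2)) τ * jacobiTheta₂ (z + -(τ / 2)) τ *
        jacobiTheta₂ z τ) := by
    intro z
    have := aux_prop (1 / 6) (1 / 6) (1 / 6) (1 / 2 + τ / 2) (-(τ / 2)) 0 z y hτ
      (by norm_num) (by ring)
    rw [hg, hg, hH, hH] at this
    linear_combination this / 2
  -- values at y
  have v1 : jacobiTheta₂ (y + 1 / 6) τ = cexp (Real.pi * I / 3) * jacobiTheta₂ (1 / 6 + τ / 2) τ := by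
    rw [← aux_sixth, hy]; congr 1; ring
  have v2 : jacobiTheta₂ (y + -(1 / 6)) τ = 0 := by
    rw [← aux_zero τ, hy]; congr 1; ring
  have v3 : jacobiTheta₂ (y + (1 / 2 + τ / 2)) τ =
      cexp (-Real.pi * I * (τ + 2 * (1 / 6))) * jacobiTheta₂ (1 / 6) τ := by
    rw [← jacobiTheta₂_add_left', ← jacobiTheta₂_add_left (1 / 6 + τ), hy]; congr 1; ring
  have v4 : jacobiTheta₂ (y + -(τ / 2)) τ = jacobiTheta₂ (2 / 3) τ := by
    rw [hy]; congr 1; ring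
  rw [v1, v2, v3, v4] at hp
  -- differentiate at zero
  have a1 := (hasDerivAt_jacobiTheta₂_fst (0 + 1 / 6) hτ).comp_add_const 0 (1 / 6)
  have a2 := (hasDerivAt_jacobiTheta₂_fst (0 + -(1 / 6)) hτ).comp_add_const 0 (-(1 / 6))
  have b1 := (hasDerivAt_jacobiTheta₂_fst (0 + (1 / 2 + τ / 2)) hτ).comp_add_const 0 (1 / 2 + τ / 2)
  have b2 := (hasDerivAt_jacobiTheta₂_fst (0 + -(τ / 2)) hτ).comp_add_const 0 (-(τ / 2))
  have b3 := hasDerivAt_jacobiTheta₂_fst 0 hτ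
  have L := ((a1.fun_pow 3).fun_sub (a2.fun_pow 3)).mul_const
    (cexp (-Real.pi * I * (τ + 2 * (1 / 6))) * jacobiTheta₂ (1 / 6) τ * jacobiTheta₂ (2 / 3) τ *
      jacobiTheta₂ y τ)
  have R := ((b1.fun_mul b2).fun_mul b3).const_mul
    ((cexp (Real.pi * I / 3) * jacobiTheta₂ (1 / 6 + τ / 2) τ) ^ 3 - 0 ^ 3)
  rw [funext hp] at L
  have h := L.unique R
  simp only [zero_add, jacobiTheta₂_neg_left, jacobiTheta₂'_neg_left, aux_zero] at h
  have c3 : cexp (Real.pi * I / 3) ^ 3 = -1 := by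
    rw [← Complex.exp_nat_mul, show ((3 : ℕ) : ℂ) * (Real.pi * I / 3) = Real.pi * I by
      push_cast; ring, Complex.exp_pi_mul_I]
  have c4 : cexp (-Real.pi * I * (τ + 2 * (1 / 6))) * cexp (Real.pi * I / 3) *
      cexp (Real.pi * I * τ) = 1 := by
    rw [← Complex.exp_add, ← Complex.exp_add]
    convert Complex.exp_zero using 2; ring
  have K := aux_K hτ
  have hS := (aux_ne hτ).2
  rw [auxS] at hS
  simp only [mul_ne_zero_iff] at hS
  have hT : jacobiTheta₂ (1 / 6) τ * jacobiTheta₂ (2 / 3) τ * jacobiTheta₂ y τ ≠ 0 :=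
    mul_ne_zero (mul_ne_zero hS.1.1.1 hS.1.1.2) hS.2
  rw [auxN, ← hy] at K
  apply mul_right_cancel₀ hT
  push_cast at h
  generalize cexp (Real.pi * I / 3) = E at *
  generalize cexp (Real.pi * I * τ) = Q at *
  generalize cexp (-Real.pi * I * (τ + 2 * (1 / 6))) = E1 at *
  generalize jacobiTheta₂' (1 / 2 + τ / 2) τ = N at *
  generalize jacobiTheta₂' (1 / 6) τ = t' at *
  generalize jacobiTheta₂ (1 / 6) τ = t at *
  generalize jacobiTheta₂ (2 / 3) τ = u at *
  generalize jacobiTheta₂ y τ = v at *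
  generalize jacobiTheta₂ (1 / 6 + τ / 2) τ = x at *
  generalize jacobiTheta₂ (τ / 2) τ = H at *
  generalize jacobiTheta₂ 0 τ = O at *
  linear_combination (E * Q / 6) * h - (t' * t ^ 2 * (t * u * v)) * c4 +
    (x ^ 3 * N * H * O * E * Q / 6) * c3 - (x ^ 3 * H * O * Q / 6) * K

lemma aux_char0 (ε : ℝ) (z τ : ℂ) : jacobiThetaChar 0 ε z τ = jacobiTheta₂ (z + ε) τ := by
  rw [jacobiThetaChar, jacobiTheta₂]
  refine tsum_congr fun n => ?_
  rw [jacobiTheta₂_term]; congr 1; push_cast; ring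

lemma aux_char1 (ε : ℝ) (τ : ℂ) : jacobiThetaChar (1 / 2) ε 0 τ =
    cexp (Real.pi * I * τ / 4 + Real.pi * I * ε) * jacobiTheta₂ (ε + τ / 2) τ := by
  rw [jacobiThetaChar, jacobiTheta₂, ← tsum_mul_left]
  refine tsum_congr fun n => ?_
  rw [jacobiTheta₂_term, ← Complex.exp_add]; congr 1; push_cast; ring

/-- `θ'[0;1/6](0,τ) · θ[0;1/6](0,τ)² = −(π/3) θ[0;0](0,τ) θ[1/2;0](0,τ) θ[1/2;1/6](0,τ)³`. -/
theorem theta_derivative_sixth (τ : ℂ) (hτ : 0 < τ.im) :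
    jacobiThetaCharDeriv 0 (1 / 6) τ * jacobiThetaChar 0 (1 / 6) 0 τ ^ 2 =
      -((Real.pi : ℂ) / 3) * jacobiThetaChar 0 0 0 τ *
        jacobiThetaChar (1 / 2) 0 0 τ * jacobiThetaChar (1 / 2) (1 / 6) 0 τ ^ 3 := by
  have hd : jacobiThetaCharDeriv 0 (1 / 6) τ = jacobiTheta₂' (1 / 6) τ := by
    rw [jacobiThetaCharDeriv]
    simp only [aux_char0]
    have h := (hasDerivAt_jacobiTheta₂_fst (0 + ((1 / 6 : ℝ) : ℂ)) hτ).comp_add_const 0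
      ((1 / 6 : ℝ) : ℂ)
    rw [h.deriv]
    congr 1; push_cast; ring
  have hm := aux_main hτ
  rw [hd, aux_char0, aux_char0, aux_char1, aux_char1]
  push_cast
  simp only [zero_add, mul_zero, add_zero]
  rw [hm]
  have he : cexp (Real.pi * I * τ / 4) * cexp (Real.pi * I * τ / 4 + Real.pi * I * (1 / 6)) ^ 3 =
      I * cexp (Real.pi * I * τ) := by
    rw [← Complex.exp_nat_mul, ← Complex.exp_add]
    have : I = cexp (Real.pi / 2 * I) := by rw [Complex.exp_pi_div_two_mul_I]
    conv_rhs => rw [this, ← Complex.exp_add, ← this]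
    congr 1; push_cast; ring
  linear_combination (Real.pi / 3 * jacobiTheta₂ 0 τ * jacobiTheta₂ (τ / 2) τ *
    jacobiTheta₂ (1 / 6 + τ / 2) τ ^ 3) * he
end

section
/- For all τ ∈ ℂ with Im τ > 0, θ'[1/5; 1/2](0,τ) · θ[1/5; 1/2](0,τ)² · θ[2/5; 1/2](0,τ)³ = (π/10) · θ[0; 0](0,τ) · θ[0; 1/2](0,τ) · θ[1/2; 0](0,τ) · ( 3·exp(6πi/5) · θ[1/10; 1/2](0,τ)³ · θ[2/5; 1/2](0,τ)² + θ[3/10; 1/2](0,τ)³ · θ[1/5; 1/2](0,τ)² ), where in [ε'; ε] the first entry is the top characteristic ε' and the second is the bottom characteristic ε. -/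
open Complex

/-- signed theta sums -/
noncomputable def T (c τ s : ℂ) : ℂ :=
  ∑' n : ℤ, c ^ n * Complex.exp ((Real.pi : ℂ) * Complex.I * τ * ((n : ℂ) + s) ^ 2)

/-- weighted signed theta sums -/
noncomputable def K (c τ s : ℂ) : ℂ :=
  ∑' n : ℤ, c ^ n * ((n : ℂ) + s) * Complex.exp ((Real.pi : ℂ) * Complex.I * τ * ((n : ℂ) + s) ^ 2)

lemma cnorm {c : ℂ} (hc : c * c = 1) : ‖c‖ = 1 := by
  have : ‖c‖ * ‖c‖ = 1 := by rw [← norm_mul, hc, norm_one]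
  nlinarith [norm_nonneg c]

lemma exp_split (τ s : ℂ) (n : ℤ) :
    Complex.exp ((Real.pi : ℂ) * Complex.I * τ * ((n : ℂ) + s) ^ 2) =
      Complex.exp ((Real.pi : ℂ) * Complex.I * τ * s ^ 2) * jacobiTheta₂_term n (s * τ) τ := by
  rw [jacobiTheta₂_term, ← Complex.exp_add]; congr 1; ring

lemma sumE {τ : ℂ} (hτ : 0 < τ.im) (s : ℂ) : Summable fun n : ℤ =>
    Complex.exp ((Real.pi : ℂ) * Complex.I * τ * ((n : ℂ) + s) ^ 2) := by
  simp_rw [exp_split]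
  exact ((summable_jacobiTheta₂_term_iff _ _).2 hτ).mul_left _

lemma sumK1 {τ : ℂ} (hτ : 0 < τ.im) (s : ℂ) : Summable fun n : ℤ => ((n : ℂ) + s) *
    Complex.exp ((Real.pi : ℂ) * Complex.I * τ * ((n : ℂ) + s) ^ 2) := by
  have h1 := ((summable_jacobiTheta₂'_term_iff (s * τ) τ).2 hτ).mul_left
    (Complex.exp ((Real.pi : ℂ) * Complex.I * τ * s ^ 2) / (2 * Real.pi * Complex.I))
  refine (h1.add ((sumE hτ s).mul_left s)).congr fun n => ?_
  rw [exp_split, jacobiTheta₂'_term]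
  have : (Real.pi : ℂ) ≠ 0 := by exact_mod_cast Real.pi_ne_zero
  have := Complex.I_ne_zero
  field_simp

lemma sumT {c τ : ℂ} (hc : c * c = 1) (hτ : 0 < τ.im) (s : ℂ) : Summable fun n : ℤ =>
    c ^ n * Complex.exp ((Real.pi : ℂ) * Complex.I * τ * ((n : ℂ) + s) ^ 2) := by
  refine Summable.of_norm ((sumE hτ s).norm.congr fun n => ?_)
  rw [norm_mul, norm_zpow, cnorm hc, one_zpow, one_mul]

lemma sumK {c τ : ℂ} (hc : c * c = 1) (hτ : 0 < τ.im) (s : ℂ) : Summable fun n : ℤ =>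
    c ^ n * ((n : ℂ) + s) * Complex.exp ((Real.pi : ℂ) * Complex.I * τ * ((n : ℂ) + s) ^ 2) := by
  refine Summable.of_norm ((sumK1 hτ s).norm.congr fun n => ?_)
  rw [norm_mul, norm_mul, norm_mul, norm_zpow, cnorm hc, one_zpow, one_mul]

/-- parity splitting of the square lattice -/
def latEquiv : (ℤ × ℤ) ⊕ (ℤ × ℤ) ≃ ℤ × ℤ where
  toFun := Sum.elim (fun z => (z.1 + z.2, z.1 - z.2)) (fun z => (z.1 + z.2, z.1 - z.2 - 1))
  invFun z := if (z.1 + z.2) % 2 = 0 then Sum.inl ((z.1 + z.2) / 2, (z.1 - z.2) / 2)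
    else Sum.inr ((z.1 + z.2 + 1) / 2, (z.1 - z.2 - 1) / 2)
  left_inv := by
    rintro (⟨p, r⟩ | ⟨p, r⟩)
    · change (if (p + r + (p - r)) % 2 = 0 then Sum.inl ((p + r + (p - r)) / 2, (p + r - (p - r)) / 2)
        else Sum.inr ((p + r + (p - r) + 1) / 2, (p + r - (p - r) - 1) / 2)) = Sum.inl (p, r)
      rw [if_pos (by omega)]
      congr 2 <;> omega
    · change (if (p + r + (p - r - 1)) % 2 = 0 then
        Sum.inl ((p + r + (p - r - 1)) / 2, (p + r - (p - r - 1)) / 2)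
        else Sum.inr ((p + r + (p - r - 1) + 1) / 2, (p + r - (p - r - 1) - 1) / 2)) = Sum.inr (p, r)
      rw [if_neg (by omega)]
      congr 2 <;> omega
  right_inv := by
    rintro ⟨m, n⟩
    dsimp only
    split_ifs with h
    · simp only [Sum.elim_inl]
      congr 1 <;> omega
    · simp only [Sum.elim_inr]
      congr 1 <;> omega

lemma hasSum_prod {F G : ℤ → ℂ} (hF : Summable F) (hG : Summable G) :
    HasSum (fun z : ℤ × ℤ => F z.1 * G z.2) ((∑' n, F n) * ∑' n, G n) := by
  rw [tsum_mul_tsum_of_summable_norm hF.norm hG.norm]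
  exact (summable_mul_of_summable_norm hF.norm hG.norm).hasSum

lemma dbl {f g F₁ G₁ F₂ G₂ F₃ G₃ F₄ G₄ : ℤ → ℂ} (hf : Summable f) (hg : Summable g)
    (hF₁ : Summable F₁) (hG₁ : Summable G₁) (hF₂ : Summable F₂) (hG₂ : Summable G₂)
    (hF₃ : Summable F₃) (hG₃ : Summable G₃) (hF₄ : Summable F₄) (hG₄ : Summable G₄)
    (he : ∀ p r, f (p + r) * g (p - r) = F₁ p * G₁ r + F₂ p * G₂ r)
    (ho : ∀ p r, f (p + r) * g (p - r - 1) = F₃ p * G₃ r + F₄ p * G₄ r) :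
    (∑' n, f n) * (∑' n, g n) = ((∑' n, F₁ n) * (∑' n, G₁ n) + (∑' n, F₂ n) * (∑' n, G₂ n)) +
      ((∑' n, F₃ n) * (∑' n, G₃ n) + (∑' n, F₄ n) * (∑' n, G₄ n)) := by
  refine (latEquiv.hasSum_iff.2 (hasSum_prod hf hg)).unique ?_
  refine HasSum.sum ?_ ?_
  · have h := (hasSum_prod hF₁ hG₁).add (hasSum_prod hF₂ hG₂)
    simp_rw [← he] at h
    exact h
  · have h := (hasSum_prod hF₃ hG₃).add (hasSum_prod hF₄ hG₄)
    simp_rw [← ho] at h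
    exact h

lemma exp_pair (τ x y a b : ℂ) (h : x ^ 2 + y ^ 2 = 2 * (a ^ 2 + b ^ 2)) :
    Complex.exp ((Real.pi : ℂ) * Complex.I * τ * x ^ 2) *
      Complex.exp ((Real.pi : ℂ) * Complex.I * τ * y ^ 2) =
    Complex.exp ((Real.pi : ℂ) * Complex.I * (2 * τ) * a ^ 2) *
      Complex.exp ((Real.pi : ℂ) * Complex.I * (2 * τ) * b ^ 2) := by
  rw [← Complex.exp_add, ← Complex.exp_add]; congr 1
  linear_combination (Real.pi : ℂ) * Complex.I * τ * h

lemma zp_even {c d : ℂ} (hc : c * c = 1) (hd : d * d = 1) (p r : ℤ) :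
    c ^ (p + r) * d ^ (p - r) = (c * d) ^ p * (c * d) ^ r := by
  have hc0 : c ≠ 0 := by rintro rfl; simp at hc
  have hd0 : d ≠ 0 := by rintro rfl; simp at hd
  have : d⁻¹ = d := inv_eq_of_mul_eq_one_left hd
  rw [zpow_add₀ hc0, sub_eq_add_neg, zpow_add₀ hd0, zpow_neg, ← inv_zpow, this, mul_zpow, mul_zpow]
  ring

lemma zp_odd {c d : ℂ} (hc : c * c = 1) (hd : d * d = 1) (p r : ℤ) :
    c ^ (p + r) * d ^ (p - r - 1) = d * ((c * d) ^ p * (c * d) ^ r) := by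
  have hd0 : d ≠ 0 := by rintro rfl; simp at hd
  have : d⁻¹ = d := inv_eq_of_mul_eq_one_left hd
  rw [zpow_sub_one₀ hd0, this, ← zp_even hc hd]
  ring

lemma TT {c d τ : ℂ} (hc : c * c = 1) (hd : d * d = 1) (hτ : 0 < τ.im) (u v : ℂ) :
    T c τ (u + v) * T d τ (u - v) = T (c * d) (2 * τ) u * T (c * d) (2 * τ) v +
      d * (T (c * d) (2 * τ) (u - 1 / 2) * T (c * d) (2 * τ) (v + 1 / 2)) := by
  have he : (c * d) * (c * d) = 1 := by linear_combination d * d * hc + hd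
  have hτ2 : 0 < (2 * τ).im := by simpa using hτ
  have z : Summable (fun _ : ℤ => (0 : ℂ)) := summable_zero
  have := dbl (sumT hc hτ (u + v)) (sumT hd hτ (u - v)) (sumT he hτ2 u) (sumT he hτ2 v) z z
    ((sumT he hτ2 (u - 1 / 2)).mul_left d) (sumT he hτ2 (v + 1 / 2)) z z ?_ ?_
  · simp only [T]
    rw [this, tsum_mul_left, tsum_zero]
    ring
  · intro p r
    have h1 := zp_even hc hd p r
    have h2 := exp_pair τ ((p + r : ℤ) + (u + v)) ((p - r : ℤ) + (u - v)) (p + u) (r + v)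
      (by push_cast; ring)
    rw [mul_mul_mul_comm, h1, h2]; ring
  · intro p r
    have h1 := zp_odd hc hd p r
    have h2 := exp_pair τ ((p + r : ℤ) + (u + v)) ((p - r - 1 : ℤ) + (u - v))
      (p + (u - 1 / 2)) (r + (v + 1 / 2)) (by push_cast; ring)
    rw [mul_mul_mul_comm, h1, h2]; ring

lemma KT {c d τ : ℂ} (hc : c * c = 1) (hd : d * d = 1) (hτ : 0 < τ.im) (u v : ℂ) :
    K c τ (u + v) * T d τ (u - v) =
      (K (c * d) (2 * τ) u * T (c * d) (2 * τ) v + T (c * d) (2 * τ) u * K (c * d) (2 * τ) v) +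
      d * (K (c * d) (2 * τ) (u - 1 / 2) * T (c * d) (2 * τ) (v + 1 / 2) +
        T (c * d) (2 * τ) (u - 1 / 2) * K (c * d) (2 * τ) (v + 1 / 2)) := by
  have he : (c * d) * (c * d) = 1 := by linear_combination d * d * hc + hd
  have hτ2 : 0 < (2 * τ).im := by simpa using hτ
  have := dbl (sumK hc hτ (u + v)) (sumT hd hτ (u - v)) (sumK he hτ2 u) (sumT he hτ2 v)
    (sumT he hτ2 u) (sumK he hτ2 v)
    ((sumK he hτ2 (u - 1 / 2)).mul_left d) (sumT he hτ2 (v + 1 / 2))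
    ((sumT he hτ2 (u - 1 / 2)).mul_left d) (sumK he hτ2 (v + 1 / 2)) ?_ ?_
  · simp only [T, K]
    rw [this, tsum_mul_left, tsum_mul_left]
    ring
  · intro p r
    have h1 := zp_even hc hd p r
    have h2 := exp_pair τ ((p + r : ℤ) + (u + v)) ((p - r : ℤ) + (u - v)) (p + u) (r + v)
      (by push_cast; ring)
    rw [mul_mul_mul_comm, h2, mul_right_comm (c ^ (p + r)), h1]; push_cast; ring
  · intro p r
    have h1 := zp_odd hc hd p r
    have h2 := exp_pair τ ((p + r : ℤ) + (u + v)) ((p - r - 1 : ℤ) + (u - v))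
      (p + (u - 1 / 2)) (r + (v + 1 / 2)) (by push_cast; ring)
    rw [mul_mul_mul_comm, h2, mul_right_comm (c ^ (p + r)), h1]; push_cast; ring

lemma zp_neg {c : ℂ} (hc : c * c = 1) (n : ℤ) : c ^ (-n) = c ^ n := by
  rw [zpow_neg, ← inv_zpow, inv_eq_of_mul_eq_one_left hc]

lemma zp_succ {c : ℂ} (hc : c * c = 1) (n : ℤ) : c ^ (n + 1) = c ^ n * c :=
  zpow_add_one₀ (by rintro rfl; simp at hc) n

lemma T_neg {c : ℂ} (hc : c * c = 1) (τ s : ℂ) : T c τ (-s) = T c τ s := by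
  unfold T
  rw [← (Equiv.neg ℤ).tsum_eq]
  refine tsum_congr fun n => ?_
  rw [Equiv.neg_apply, zp_neg hc]; push_cast; congr 2; ring

lemma K_neg {c : ℂ} (hc : c * c = 1) (τ s : ℂ) : K c τ (-s) = -K c τ s := by
  unfold K
  rw [← (Equiv.neg ℤ).tsum_eq, ← tsum_neg]
  refine tsum_congr fun n => ?_
  rw [Equiv.neg_apply, zp_neg hc,
    show (((-n : ℤ) : ℂ) + -s) = -((n : ℂ) + s) by push_cast; ring, neg_sq]; ring

lemma T_succ {c : ℂ} (hc : c * c = 1) (τ s : ℂ) : T c τ (s + 1) = c * T c τ s := by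
  unfold T
  rw [← (Equiv.addRight (1 : ℤ)).tsum_eq (fun n : ℤ => c ^ n * cexp (Real.pi * I * τ * (n + s) ^ 2)),
    ← tsum_mul_left]
  refine tsum_congr fun n => ?_
  rw [Equiv.coe_addRight, zp_succ hc,
    show (((n + 1 : ℤ) : ℂ) + s) = ((n : ℂ) + (s + 1)) by push_cast; ring]
  linear_combination (-c ^ n * cexp (Real.pi * I * τ * (n + (s + 1)) ^ 2)) * hc

lemma K_succ {c : ℂ} (hc : c * c = 1) (τ s : ℂ) : K c τ (s + 1) = c * K c τ s := by
  unfold K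
  rw [← (Equiv.addRight (1 : ℤ)).tsum_eq
    (fun n : ℤ => c ^ n * (n + s) * cexp (Real.pi * I * τ * (n + s) ^ 2)), ← tsum_mul_left]
  refine tsum_congr fun n => ?_
  rw [Equiv.coe_addRight, zp_succ hc,
    show (((n + 1 : ℤ) : ℂ) + s) = ((n : ℂ) + (s + 1)) by push_cast; ring]
  linear_combination
    (-c ^ n * (n + (s + 1)) * cexp (Real.pi * I * τ * (n + (s + 1)) ^ 2)) * hc

lemma neg_one_sq' : (-1 : ℂ) * (-1) = 1 := by norm_num

lemma T_half (τ s : ℂ) : T (-1) τ (1 / 2 - s) = -T (-1) τ (1 / 2 + s) := by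
  have := T_succ neg_one_sq' τ (s - 1 / 2)
  rw [show s - 1 / 2 + 1 = 1 / 2 + s by ring,
    show s - 1 / 2 = -(1 / 2 - s) by ring, T_neg neg_one_sq'] at this
  linear_combination this

lemma K_half (τ s : ℂ) : K (-1) τ (1 / 2 - s) = K (-1) τ (1 / 2 + s) := by
  have := K_succ neg_one_sq' τ (s - 1 / 2)
  rw [show s - 1 / 2 + 1 = 1 / 2 + s by ring, show s - 1 / 2 = -(1 / 2 - s) by ring,
    K_neg neg_one_sq'] at this
  linear_combination -this

lemma T_half0 (τ : ℂ) : T (-1) τ (1 / 2) = 0 := by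
  have := T_half τ 0
  simp only [sub_zero, add_zero] at this
  linear_combination this / 2

/-- `h(x+y) h(x-y)` -/
lemma W0 {τ : ℂ} (hτ : 0 < τ.im) (x y : ℂ) :
    T (-1) τ (1 / 2 + (x + y)) * T (-1) τ (1 / 2 + (x - y)) =
      T 1 (2 * τ) (1 / 2 + x) * T 1 (2 * τ) y - T 1 (2 * τ) x * T 1 (2 * τ) (1 / 2 + y) := by
  have := TT neg_one_sq' neg_one_sq' hτ (1 / 2 + x) y
  rw [neg_one_sq', show (1 : ℂ) / 2 + x - 1 / 2 = x by ring, add_comm y (1 / 2)] at this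
  rw [← add_assoc, ← add_sub_assoc, this]; ring

lemma W1 {τ : ℂ} (hτ : 0 < τ.im) (x y : ℂ) :
    K (-1) τ (1 / 2 + (x + y)) * T (-1) τ (1 / 2 + (x - y)) +
      T (-1) τ (1 / 2 + (x + y)) * K (-1) τ (1 / 2 + (x - y)) =
      2 * (K 1 (2 * τ) (1 / 2 + x) * T 1 (2 * τ) y - K 1 (2 * τ) x * T 1 (2 * τ) (1 / 2 + y)) := by
  have h1 := KT neg_one_sq' neg_one_sq' hτ (1 / 2 + x) y
  have h2 := KT neg_one_sq' neg_one_sq' hτ (1 / 2 + x) (-y)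
  have o : (1 : ℂ) * 1 = 1 := one_mul 1
  have hT := T_succ o (2 * τ) (y - 1 / 2)
  have hK := K_succ o (2 * τ) (y - 1 / 2)
  rw [show y - 1 / 2 + 1 = 1 / 2 + y by ring] at hT hK
  rw [neg_one_sq', show (1 : ℂ) / 2 + x - 1 / 2 = x by ring] at h1 h2
  rw [T_neg o, K_neg o, show -y + 1 / 2 = -(y - 1 / 2) by ring, T_neg o, K_neg o,
    sub_neg_eq_add, ← sub_eq_add_neg] at h2
  rw [add_comm y (1 / 2)] at h1
  rw [← add_assoc, ← add_sub_assoc]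
  rw [h1, mul_comm (T (-1) _ _) (K (-1) _ _), h2, hT, hK]; ring

lemma triple {τ : ℂ} (hτ : 0 < τ.im) (s : ℂ) :
    3 * K (-1) τ (1 / 2 + s) * T (-1) τ (1 / 2 + s) ^ 2 * T (-1) τ (1 / 2 + 3 * s) -
      T (-1) τ (1 / 2 + s) ^ 3 * K (-1) τ (1 / 2 + 3 * s) =
    K (-1) τ (1 / 2) * T (-1) τ (1 / 2 + 2 * s) ^ 3 := by
  -- y = s, u = 2s, v = 0
  have a1 := W1 hτ s s
  have a2 := W0 hτ (2 * s) 0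
  have a3 := W1 hτ s (2 * s)
  have a4 := W0 hτ s 0
  have a5 := W1 hτ s 0
  have a6 := W0 hτ s (2 * s)
  rw [show s - s = 0 by ring, show s + s = 2 * s by ring, add_zero, T_half0] at a1
  rw [sub_zero, add_zero] at a2 a4 a5
  rw [show s + 2 * s = 3 * s by ring, show s - 2 * s = - s by ring,
    ← sub_eq_add_neg, T_half] at a3 a6
  rw [K_half] at a3
  generalize T 1 (2 * τ) (1 / 2 + s) = Bs at *
  generalize T 1 (2 * τ) s = As at *
  generalize T 1 (2 * τ) (1 / 2 + 2 * s) = Bu at *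
  generalize T 1 (2 * τ) (2 * s) = Au at *
  generalize T 1 (2 * τ) (1 / 2 + 0) = Bv at *
  generalize T 1 (2 * τ) 0 = Av at *
  generalize K 1 (2 * τ) (1 / 2 + s) = Cs at *
  generalize K 1 (2 * τ) s = Ds at *
  generalize T (-1) τ (1 / 2 + s) = h1 at *
  generalize T (-1) τ (1 / 2 + 2 * s) = h2 at *
  generalize T (-1) τ (1 / 2 + 3 * s) = h3 at *
  generalize K (-1) τ (1 / 2 + s) = k1 at *
  generalize K (-1) τ (1 / 2 + 3 * s) = k3 at *
  generalize K (-1) τ (1 / 2) = k0 at *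
  have e1 : k0 * h2 ^ 3 = (2 * (Cs * As - Ds * Bs)) * (Bu * Av - Au * Bv) := by
    rw [← a1, ← a2]; ring
  have e2 : (k3 * -h1 + h3 * k1) * h1 ^ 2 = (2 * (Cs * Au - Ds * Bu)) * (Bs * Av - As * Bv) := by
    rw [← a3, ← a4]; ring
  have e3 : 2 * k1 * h1 * (h3 * -h1) = (2 * (Cs * Av - Ds * Bv)) * (Bs * Au - As * Bu) := by
    rw [← a5, ← a6]; ring
  linear_combination e2 - e3 - e1

lemma R1 {τ : ℂ} (hτ : 0 < τ.im) : T 1 τ 0 * T (-1) τ 0 = T (-1) (2 * τ) 0 ^ 2 := by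
  have := TT (one_mul 1) neg_one_sq' hτ 0 0
  simp only [zero_add, add_zero, sub_zero, one_mul, T_half0, mul_zero] at this
  rw [this]; ring

lemma R2 {τ : ℂ} (hτ : 0 < τ.im) :
    T 1 τ (1 / 2) ^ 2 = 2 * T 1 (2 * τ) (1 / 2) * T 1 (2 * τ) 0 := by
  have := TT (one_mul 1) (one_mul 1) hτ (1 / 2) 0
  rw [zero_add, sub_self] at this
  simp only [add_zero, sub_zero, one_mul] at this
  rw [sq, this]; ring

lemma R3 {τ : ℂ} (hτ : 0 < τ.im) :
    K (-1) τ (1 / 2) * T 1 τ (1 / 2) = 2 * K (-1) (2 * τ) (1 / 2) * T (-1) (2 * τ) 0 := by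
  have := KT neg_one_sq' (one_mul 1) hτ (1 / 2) 0
  rw [zero_add, sub_self] at this
  simp only [add_zero, sub_zero, mul_one, one_mul, T_half0] at this
  rw [this]; ring

open Filter Topology in
lemma limW (S : Finset ℤ) (c w : ℤ → ℂ) (h1 : ∀ n ∈ S, w n = 1) (h2 : ∀ n ∉ S, ‖w n‖ < 1)
    (hs : Summable fun n => c n * w n) :
    Tendsto (fun N : ℕ => ∑' n, c n * w n ^ (2 ^ N)) atTop (𝓝 (∑ n ∈ S, c n)) := by
  have hle : ∀ n, ‖w n‖ ≤ 1 := fun n => by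
    by_cases h : n ∈ S
    · simp [h1 n h]
    · exact (h2 n h).le
  have e : ∑ n ∈ S, c n = ∑' n, if n ∈ S then c n else 0 := by
    rw [tsum_eq_sum (s := S)]
    · exact Finset.sum_congr rfl fun n hn => by simp [hn]
    · intro n hn; simp [hn]
  rw [e]
  refine tendsto_tsum_of_dominated_convergence hs.norm ?_ ?_
  · intro n
    by_cases h : n ∈ S
    · simp [h, h1 n h]
    · simp only [h, if_false]
      have := (tendsto_pow_atTop_nhds_zero_of_norm_lt_one (h2 n h)).comp
        (tendsto_pow_atTop_atTop_of_one_lt (one_lt_two : (1 : ℕ) < 2))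
      simpa using this.const_mul (c n)
  · refine Eventually.of_forall fun N n => ?_
    rw [norm_mul, norm_mul, norm_pow]
    exact mul_le_mul_of_nonneg_left (pow_le_of_le_one (norm_nonneg _) (hle n) (by positivity))
      (norm_nonneg _)

lemma norm_w {τ : ℂ} (hτ : 0 < τ.im) {m : ℤ} (hm : 0 < m) :
    ‖Complex.exp ((Real.pi : ℂ) * Complex.I * τ * (m : ℂ))‖ < 1 := by
  rw [Complex.norm_exp, Real.exp_lt_one_iff]
  have : ((Real.pi : ℂ) * Complex.I * τ * (m : ℂ)).re = -(Real.pi * τ.im * m) := by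
    simp [Complex.mul_re, Complex.mul_im]
  rw [this]
  have : (0 : ℝ) < m := by exact_mod_cast hm
  have := Real.pi_pos
  have : 0 < Real.pi * τ.im * m := by positivity
  linarith

lemma pow_w (τ x : ℂ) (N : ℕ) :
    Complex.exp ((Real.pi : ℂ) * Complex.I * τ * x) ^ (2 ^ N) =
      Complex.exp ((Real.pi : ℂ) * Complex.I * (2 ^ N * τ) * x) := by
  rw [← Complex.exp_nat_mul]; congr 1; push_cast; ring

open Filter Topology in
lemma lim0 {c τ : ℂ} (hc : c * c = 1) (hτ : 0 < τ.im) :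
    Tendsto (fun N : ℕ => T c (2 ^ N * τ) 0) atTop (𝓝 1) := by
  have := limW {0} (fun n => c ^ n)
    (fun n => Complex.exp ((Real.pi : ℂ) * Complex.I * τ * ((n ^ 2 : ℤ) : ℂ))) (by simp) ?_ ?_
  · simp only [Finset.sum_singleton, zpow_zero] at this
    refine this.congr fun N => tsum_congr fun n => ?_
    rw [pow_w]; push_cast; rw [add_zero]
  · intro n hn
    refine norm_w hτ ?_
    have : n ≠ 0 := by simpa using hn
    positivity
  · refine (sumT hc hτ 0).congr fun n => ?_
    push_cast; rw [add_zero]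

lemma half_exp (τ : ℂ) (n : ℤ) :
    Complex.exp ((Real.pi : ℂ) * Complex.I * τ * ((n : ℂ) + 1 / 2) ^ 2) =
    Complex.exp ((Real.pi : ℂ) * Complex.I * τ / 4) *
      Complex.exp ((Real.pi : ℂ) * Complex.I * τ * ((n * (n + 1) : ℤ) : ℂ)) := by
  rw [← Complex.exp_add]; congr 1; push_cast; ring

open Filter Topology in
lemma limHalf {τ : ℂ} (hτ : 0 < τ.im) (c : ℤ → ℂ) (hs : Summable fun n : ℤ =>
      c n * Complex.exp ((Real.pi : ℂ) * Complex.I * τ * ((n : ℂ) + 1 / 2) ^ 2)) :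
    Tendsto (fun N : ℕ => (∑' n : ℤ, c n *
        Complex.exp ((Real.pi : ℂ) * Complex.I * (2 ^ N * τ) * ((n : ℂ) + 1 / 2) ^ 2)) /
          Complex.exp ((Real.pi : ℂ) * Complex.I * (2 ^ N * τ) / 4)) atTop
      (𝓝 (c 0 + c (-1))) := by
  have := limW {0, -1} c
    (fun n => Complex.exp ((Real.pi : ℂ) * Complex.I * τ * ((n * (n + 1) : ℤ) : ℂ)))
    (by simp) ?_ ?_
  · rw [Finset.sum_pair (by norm_num)] at this
    refine this.congr fun N => ?_
    rw [eq_div_iff (Complex.exp_ne_zero _), ← tsum_mul_right]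
    refine tsum_congr fun n => ?_
    rw [pow_w, half_exp]; ring
  · intro n hn
    refine norm_w hτ ?_
    have : n ≠ 0 ∧ n ≠ -1 := by simpa using hn
    rcases lt_or_gt_of_ne this.1 with h | h
    · have : n + 1 < 0 := by omega
      nlinarith
    · positivity
  · refine (hs.mul_left (Complex.exp ((Real.pi : ℂ) * Complex.I * τ / 4))⁻¹).congr fun n => ?_
    rw [half_exp]
    field_simp

lemma im2 {τ : ℂ} (hτ : 0 < τ.im) : 0 < (2 * τ).im := by simpa using hτ

lemma iter {Q : ℂ → Prop} (h : ∀ τ : ℂ, 0 < τ.im → Q τ → Q (2 * τ)) {τ : ℂ} (hτ : 0 < τ.im)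
    (h0 : Q τ) (N : ℕ) : Q (2 ^ N * τ) := by
  suffices 0 < (2 ^ N * τ).im ∧ Q (2 ^ N * τ) from this.2
  induction N with
  | zero => simpa using ⟨hτ, h0⟩
  | succ N ih =>
    rw [show (2 : ℂ) ^ (N + 1) * τ = 2 * (2 ^ N * τ) by ring]
    exact ⟨im2 ih.1, h _ ih.1 ih.2⟩

lemma th4_ne {τ : ℂ} (hτ : 0 < τ.im) : T (-1) τ 0 ≠ 0 := by
  intro h0
  have := iter (Q := fun τ => T (-1) τ 0 = 0) (fun τ hτ h => by
    have := R1 hτ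
    rw [h, mul_zero] at this
    exact pow_eq_zero_iff two_ne_zero |>.1 this.symm) hτ h0
  have l := lim0 neg_one_sq' hτ
  simp_rw [this] at l
  exact zero_ne_one (tendsto_nhds_unique tendsto_const_nhds l)

lemma th3_ne {τ : ℂ} (hτ : 0 < τ.im) : T 1 τ 0 ≠ 0 := by
  intro h0
  have := R1 hτ
  rw [h0, zero_mul] at this
  exact th4_ne (im2 hτ) (pow_eq_zero_iff two_ne_zero |>.1 this.symm)

open Filter Topology in
lemma limT2 {τ : ℂ} (hτ : 0 < τ.im) : Tendsto (fun N : ℕ => T 1 (2 ^ N * τ) (1 / 2) /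
          Complex.exp ((Real.pi : ℂ) * Complex.I * (2 ^ N * τ) / 4)) atTop (𝓝 2) := by
  have := limHalf hτ (fun n => (1 : ℂ) ^ n) (sumT (one_mul 1) hτ _)
  simp only [one_zpow] at this
  rw [one_add_one_eq_two] at this
  simpa only [T, one_zpow] using this

open Filter Topology in
lemma limK2 {τ : ℂ} (hτ : 0 < τ.im) : Tendsto (fun N : ℕ => K (-1) (2 ^ N * τ) (1 / 2) /
          Complex.exp ((Real.pi : ℂ) * Complex.I * (2 ^ N * τ) / 4)) atTop (𝓝 1) := by
  have := limHalf hτ (fun n => (-1 : ℂ) ^ n * (n + 1 / 2)) (sumK neg_one_sq' hτ _)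
  have e : (-1 : ℂ) ^ (0 : ℤ) * (((0 : ℤ) : ℂ) + 1 / 2) +
    (-1 : ℂ) ^ (-1 : ℤ) * (((-1 : ℤ) : ℂ) + 1 / 2) = 1 := by norm_num
  rw [e] at this
  exact this

lemma th2_ne {τ : ℂ} (hτ : 0 < τ.im) : T 1 τ (1 / 2) ≠ 0 := by
  intro h0
  have := iter (Q := fun τ => T 1 τ (1 / 2) = 0) (fun τ hτ h => by
    have := R2 hτ
    rw [h] at this
    have h3 := th3_ne (im2 hτ)
    simpa [h3] using this) hτ h0
  have l := limT2 hτ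
  simp_rw [this, zero_div] at l
  exact two_ne_zero (tendsto_nhds_unique tendsto_const_nhds l).symm

open Filter Topology in
/-- Jacobi's derivative formula -/
lemma jac {τ : ℂ} (hτ : 0 < τ.im) :
    2 * K (-1) τ (1 / 2) = T 1 τ 0 * T (-1) τ 0 * T 1 τ (1 / 2) := by
  have hP : ∀ {τ : ℂ}, 0 < τ.im → T 1 τ 0 * T (-1) τ 0 * T 1 τ (1 / 2) ≠ 0 := fun h =>
    mul_ne_zero (mul_ne_zero (th3_ne h) (th4_ne h)) (th2_ne h)
  have key := iter (Q := fun σ => 2 * K (-1) σ (1 / 2) / (T 1 σ 0 * T (-1) σ 0 * T 1 σ (1 / 2)) =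
      2 * K (-1) τ (1 / 2) / (T 1 τ 0 * T (-1) τ 0 * T 1 τ (1 / 2))) (fun σ hσ h => by
    rw [← h, div_eq_div_iff (hP (im2 hσ)) (hP hσ)]
    have r1 := R1 hσ
    have r2 := R2 hσ
    have r3 := R3 hσ
    rw [r1]
    linear_combination (-T (-1) (2 * σ) 0 * T 1 σ (1 / 2)) * r3
      + K (-1) σ (1 / 2) * T (-1) (2 * σ) 0 * r2) hτ rfl
  have l1 := ((limK2 hτ).const_mul 2).div
    (((lim0 (one_mul 1) hτ).mul (lim0 neg_one_sq' hτ)).mul (limT2 hτ)) (by norm_num)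
  have l2 : Tendsto (fun _ : ℕ => 2 * K (-1) τ (1 / 2) /
      (T 1 τ 0 * T (-1) τ 0 * T 1 τ (1 / 2))) atTop (𝓝 (2 * 1 / (1 * 1 * 2))) := by
    refine l1.congr fun N => ?_
    rw [← key N]
    simp only [Pi.div_apply]
    rw [← mul_div_assoc, ← mul_div_assoc, div_div_div_cancel_right₀ (Complex.exp_ne_zero _)]
  have := tendsto_nhds_unique tendsto_const_nhds l2
  rw [div_eq_iff (hP hτ)] at this
  rw [this]; norm_num

lemma conv0 (a : ℝ) (τ : ℂ) : jacobiThetaChar a 0 0 τ = T 1 τ a := by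
  refine tsum_congr fun n => ?_
  rw [one_zpow, one_mul]; congr 1; push_cast; ring

lemma exp_half (a : ℂ) (n : ℤ) : Complex.exp (Real.pi * I * (n + a)) =
    Complex.exp (Real.pi * I * a) * (-1) ^ n := by
  rw [← Complex.exp_pi_mul_I, ← Complex.exp_int_mul, ← Complex.exp_add]; congr 1; ring

lemma conv1 (a : ℝ) (τ : ℂ) :
    jacobiThetaChar a (1 / 2) 0 τ = Complex.exp (Real.pi * I * a) * T (-1) τ a := by
  rw [T, ← tsum_mul_left]
  refine tsum_congr fun n => ?_
  rw [← mul_assoc, ← exp_half, ← Complex.exp_add]; congr 1; push_cast; ring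

lemma char_eq (a b : ℝ) (z τ : ℂ) : jacobiThetaChar a b z τ =
    Complex.exp (Real.pi * I * a ^ 2 * τ + 2 * Real.pi * I * a * (z + b)) *
      jacobiTheta₂ (z + (a * τ + b)) τ := by
  rw [jacobiTheta₂, ← tsum_mul_left]
  refine tsum_congr fun n => ?_
  rw [jacobiTheta₂_term, ← Complex.exp_add]; congr 1; ring

lemma conv2 (a : ℝ) {τ : ℂ} (hτ : 0 < τ.im) : jacobiThetaCharDeriv a (1 / 2) τ =
    2 * Real.pi * I * Complex.exp (Real.pi * I * a) * K (-1) τ a := by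
  set b : ℝ := 1 / 2 with hb
  have d1 : HasDerivAt (fun z : ℂ => Complex.exp (Real.pi * I * a ^ 2 * τ + 2 * Real.pi * I * a * (z + b)))
      (Complex.exp (Real.pi * I * a ^ 2 * τ + 2 * Real.pi * I * a * (0 + b)) *
        (2 * Real.pi * I * a * 1)) 0 :=
    ((((hasDerivAt_id (0 : ℂ)).add_const (b : ℂ)).const_mul (2 * Real.pi * I * a)).const_add _).cexp
  have d2 : HasDerivAt (fun z : ℂ => jacobiTheta₂ (z + (a * τ + b)) τ)
      (jacobiTheta₂' (0 + (a * τ + b)) τ) 0 :=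
    HasDerivAt.comp_add_const 0 _ (hasDerivAt_jacobiTheta₂_fst (0 + (a * τ + b)) hτ)
  have d3 := (d1.mul d2).deriv
  rw [jacobiThetaCharDeriv, funext fun z => char_eq a b z τ]
  refine Eq.trans d3 ?_
  have s1 := (hasSum_jacobiTheta₂_term (0 + (a * τ + b)) hτ).mul_left
    (Complex.exp (Real.pi * I * a ^ 2 * τ + 2 * Real.pi * I * a * (0 + b)) *
        (2 * Real.pi * I * a * 1))
  have s2 := (hasSum_jacobiTheta₂'_term (0 + (a * τ + b)) hτ).mul_left
    (Complex.exp (Real.pi * I * a ^ 2 * τ + 2 * Real.pi * I * a * (0 + b)))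
  rw [← (s1.add s2).tsum_eq, K, ← tsum_mul_left]
  refine tsum_congr fun n => ?_
  have e1 : Complex.exp (Real.pi * I * a ^ 2 * τ + 2 * Real.pi * I * a * (0 + b)) *
      jacobiTheta₂_term n (0 + (a * τ + b)) τ =
      Complex.exp (Real.pi * I * a) * (-1) ^ n *
        Complex.exp (Real.pi * I * τ * (n + a) ^ 2) := by
    rw [← exp_half, jacobiTheta₂_term, ← Complex.exp_add, ← Complex.exp_add, hb]
    congr 1; push_cast; ring
  rw [jacobiTheta₂'_term]
  linear_combination (2 * Real.pi * I * (n + a)) * e1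

/-- `θ'[1/5;1/2](0,τ) θ[1/5;1/2](0,τ)² θ[2/5;1/2](0,τ)³
  = (π/10) θ[0;0] θ[0;1/2] θ[1/2;0] (3 e^{6πi/5} θ[1/10;1/2]³ θ[2/5;1/2]²
      + θ[3/10;1/2]³ θ[1/5;1/2]²)`. -/
theorem theta_derivative_fifth_half (τ : ℂ) (hτ : 0 < τ.im) :
    jacobiThetaCharDeriv (1 / 5) (1 / 2) τ * jacobiThetaChar (1 / 5) (1 / 2) 0 τ ^ 2 *
        jacobiThetaChar (2 / 5) (1 / 2) 0 τ ^ 3 =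
      ((Real.pi : ℂ) / 10) * jacobiThetaChar 0 0 0 τ * jacobiThetaChar 0 (1 / 2) 0 τ *
        jacobiThetaChar (1 / 2) 0 0 τ *
        (3 * Complex.exp (6 * (Real.pi : ℂ) * Complex.I / 5) *
            jacobiThetaChar (1 / 10) (1 / 2) 0 τ ^ 3 *
            jacobiThetaChar (2 / 5) (1 / 2) 0 τ ^ 2 +
          jacobiThetaChar (3 / 10) (1 / 2) 0 τ ^ 3 *
            jacobiThetaChar (1 / 5) (1 / 2) 0 τ ^ 2) := by
  have t1 := triple hτ (1 / 10)
  have t3 := triple hτ (3 / 10)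
  have hj := jac hτ
  have h9 := T_succ neg_one_sq' τ (1 / 2 + -(1 / 10))
  have k9 := K_succ neg_one_sq' τ (1 / 2 + -(1 / 10))
  have h6 := T_succ neg_one_sq' τ (1 / 2 + -(4 / 10))
  have e1 := T_half τ (1 / 10)
  have e2 := T_half τ (2 / 10)
  have e3 := T_half τ (3 / 10)
  have f1 := K_half τ (1 / 10)
  have f3 := K_half τ (3 / 10)
  rw [conv2 _ hτ, conv0, conv0, conv1, conv1, conv1, conv1, conv1]
  have x1 : Complex.exp (Real.pi * I * ((1 / 10 : ℝ) : ℂ)) ^ 10 = -1 := by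
    rw [← Complex.exp_nat_mul, ← Complex.exp_pi_mul_I]; congr 1; push_cast; ring
  have x6 : Complex.exp (Real.pi * I * ((1 / 10 : ℝ) : ℂ)) ^ 5 = I := by
    rw [← Complex.exp_nat_mul]
    refine Eq.trans ?_ Complex.exp_pi_div_two_mul_I
    congr 1; push_cast; ring
  have x2 : Complex.exp (Real.pi * I * ((1 / 5 : ℝ) : ℂ)) =
      Complex.exp (Real.pi * I * ((1 / 10 : ℝ) : ℂ)) ^ 2 := by
    rw [← Complex.exp_nat_mul]; congr 1; push_cast; ring
  have x3 : Complex.exp (Real.pi * I * ((3 / 10 : ℝ) : ℂ)) =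
      Complex.exp (Real.pi * I * ((1 / 10 : ℝ) : ℂ)) ^ 3 := by
    rw [← Complex.exp_nat_mul]; congr 1; push_cast; ring
  have x4 : Complex.exp (Real.pi * I * ((2 / 5 : ℝ) : ℂ)) =
      Complex.exp (Real.pi * I * ((1 / 10 : ℝ) : ℂ)) ^ 4 := by
    rw [← Complex.exp_nat_mul]; congr 1; push_cast; ring
  have x5 : Complex.exp (6 * Real.pi * I / 5) =
      Complex.exp (Real.pi * I * ((1 / 10 : ℝ) : ℂ)) ^ 12 := by
    rw [← Complex.exp_nat_mul]; congr 1; push_cast; ring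
  have x0 : Complex.exp (Real.pi * I * ((0 : ℝ) : ℂ)) = 1 := by simp
  rw [x0, x2, x3, x4, x5]
  clear x2 x3 x4 x5 x0
  generalize Complex.exp (Real.pi * I * ((1 / 10 : ℝ) : ℂ)) = w at *
  push_cast
  norm_num at t1 t3 hj h9 k9 h6 e1 e2 e3 f1 f3 ⊢
  rw [h9, k9, h6, e1, f1] at t3
  rw [e1, e2, e3, f3, ← x6]
  generalize T (-1) τ (4 / 5) = a at *
  generalize T (-1) τ (3 / 5) = b at *
  generalize T (-1) τ (1 / 10) = c at *
  generalize T (-1) τ (7 / 10) = d at *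
  generalize K (-1) τ (4 / 5) = k3 at *
  generalize K (-1) τ (3 / 5) = k1 at *
  generalize K (-1) τ (1 / 2) = k0 at *
  have m : 10 * k3 * a ^ 2 * b ^ 3 = -k0 * (3 * b ^ 2 * c ^ 3 + a ^ 2 * d ^ 3) := by
    linear_combination 3 * b ^ 2 * t3 - a ^ 2 * t1
  linear_combination (Real.pi / 5 * w ^ 13) * m
    + (Real.pi / 10 * (3 * w ^ 23 * c ^ 3 * b ^ 2 - w ^ 13 * d ^ 3 * a ^ 2)) * hj
    + (-2 * Real.pi * w ^ 13 * k3 * a ^ 2 * b ^ 3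
      - 3 * Real.pi / 5 * k0 * w ^ 13 * c ^ 3 * b ^ 2) * x1
end
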